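/- Let g : ℝ^n → ℝ be M-Lipschitz w.r.t. the Euclidean norm and e uniform on the Euclidean unit sphere in ℝ^n. Then E[(g(e + x) − g(−e + x))²] ≤ 12M²/n for any fixed x (via the fourth-moment concentration bound E[(g(e) − E g(e))⁴] ≤ 9M⁴/n²). -/

import Mathlib

open MeasureTheory RealInnerProductSpace
open ProbabilityTheory


theorem ssd_pi_ac : ∀ (n : ℕ) (μ ν : Measure ℝ) [SigmaFinite μ] [SigmaFinite ν], μ ≪ ν →
    Measure.pi (fun _ : Fin n => μ) ≪ Measure.pi (fun _ : Fin n => ν)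
  | 0, μ, ν, _, _, h => by
    rw [Measure.pi_of_empty, Measure.pi_of_empty]
  | n + 1, μ, ν, _, _, h => by
    have ih := ssd_pi_ac n μ ν h
    have h1 := (measurePreserving_piFinSuccAbove (fun _ : Fin (n+1) => μ) 0).symm
    have h2 := (measurePreserving_piFinSuccAbove (fun _ : Fin (n+1) => ν) 0).symm
    rw [← h1.map_eq, ← h2.map_eq]
    exact (h.prod ih).map (MeasurableEquiv.measurable _)

theorem ssd_gauss_ac (n : ℕ) :
    stdGaussian (EuclideanSpace ℝ (Fin n)) ≪ volume := by
  rw [← map_pi_eq_stdGaussian, ← (PiLp.volume_preserving_toLp (Fin n)).map_eq]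
  exact (ssd_pi_ac n _ _ (gaussianReal_absolutelyContinuous 0 one_ne_zero)).map (by fun_prop)

theorem ssd_charFun_inv {n : ℕ} (P : Measure (EuclideanSpace ℝ (Fin n)))
    (hinv : ∀ O : EuclideanSpace ℝ (Fin n) ≃ₗᵢ[ℝ] EuclideanSpace ℝ (Fin n),
      P.map O = P) (s t : EuclideanSpace ℝ (Fin n)) (h : ‖s‖ = ‖t‖) :
    charFun P s = charFun P t := by
  set O := Submodule.reflection (ℝ ∙ (s - t))ᗮ
  have hO : O s = t := Submodule.reflection_sub h
  conv_rhs => rw [← hinv O]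
  rw [charFun_apply, charFun_apply, integral_map (by fun_prop) (by fun_prop), ← hO]
  simp

theorem ssd_gauss_polar {n : ℕ} (P : Measure (EuclideanSpace ℝ (Fin n))) [IsProbabilityMeasure P]
    (hsphere : ∀ᵐ e ∂P, ‖e‖ = 1)
    (hinv : ∀ O : EuclideanSpace ℝ (Fin n) ≃ₗᵢ[ℝ] EuclideanSpace ℝ (Fin n),
      P.map O = P) :
    ((stdGaussian (EuclideanSpace ℝ (Fin n))).prod P).map (fun p => ‖p.1‖ • p.2) =
      stdGaussian (EuclideanSpace ℝ (Fin n)) := by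
  set γ := stdGaussian (EuclideanSpace ℝ (Fin n))
  have := Measure.isProbabilityMeasure_map (μ := γ.prod P)
    (f := fun p => ‖p.1‖ • p.2) (by fun_prop)
  apply Measure.ext_of_charFun
  ext t
  have key : ∀ f : EuclideanSpace ℝ (Fin n) × EuclideanSpace ℝ (Fin n) → ℝ, Continuous f →
      Integrable (fun p => Complex.exp (f p * Complex.I)) (γ.prod P) := by
    intro f hf
    refine Integrable.mono' (integrable_const (1:ℝ)) (by fun_prop) (ae_of_all _ fun p => ?_)
    rw [Complex.norm_exp_ofReal_mul_I]
  have hg : ∀ s t : EuclideanSpace ℝ (Fin n), ‖s‖ = ‖t‖ → charFun γ s = charFun γ t := by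
    intro s t h
    simp only [γ, charFun_stdGaussian, h]
  calc charFun (Measure.map (fun p => ‖p.1‖ • p.2) (γ.prod P)) t 
      = ∫ p, Complex.exp ((inner ℝ (‖p.1‖ • p.2) t : ℝ) * Complex.I) ∂(γ.prod P) := by
        rw [charFun_apply, integral_map (by fun_prop) (by fun_prop)]
    _ = ∫ x, charFun P (‖x‖ • t) ∂γ := by
        rw [integral_prod _ (key _ (by fun_prop))]
        simp only [charFun_apply, inner_smul_left, inner_smul_right]
        rfl
    _ = ∫ x, charFun P (‖t‖ • x) ∂γ := by
        congr 1; ext x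
        apply ssd_charFun_inv P hinv
        simp [norm_smul, mul_comm]
    _ = ∫ p, Complex.exp ((inner ℝ p.2 (‖t‖ • p.1) : ℝ) * Complex.I) ∂(γ.prod P) := by
        rw [integral_prod _ (key _ (by fun_prop))]
        simp only [charFun_apply]
    _ = ∫ e, charFun γ (‖t‖ • e) ∂P := by
        rw [integral_prod_symm _ (key _ (by fun_prop))]
        simp only [charFun_apply, inner_smul_right, real_inner_comm]
    _ = ∫ e, charFun γ t ∂P := by
        apply integral_congr_ae
        filter_upwards [hsphere] with e he
        apply hg
        simp [norm_smul, he]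
    _ = charFun γ t := by simp

theorem ssd_gauss_norm_sq (n : ℕ) :
    ∫ x, ‖x‖ ^ 2 ∂(stdGaussian (EuclideanSpace ℝ (Fin n))) = n := by
  have hi : ∀ i : Fin n, Integrable (fun x : EuclideanSpace ℝ (Fin n) => (x i) ^ 2)
      (stdGaussian (EuclideanSpace ℝ (Fin n))) := fun i =>
    ((IsGaussian.memLp_dual _ (EuclideanSpace.proj i) 2 (by simp))).integrable_sq
  simp_rw [EuclideanSpace.real_norm_sq_eq]
  rw [integral_finsetSum _ (fun i _ => hi i)]
  have : ∀ i : Fin n, ∫ x, (x i) ^ 2 ∂(stdGaussian (EuclideanSpace ℝ (Fin n))) = 1 := by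
    intro i
    have h := variance_dual_stdGaussian (EuclideanSpace.proj i : StrongDual ℝ (EuclideanSpace ℝ (Fin n)))
    rw [variance_of_integral_eq_zero (by fun_prop) (integral_strongDual_stdGaussian _)] at h
    have h2 : ‖(EuclideanSpace.proj i : StrongDual ℝ (EuclideanSpace ℝ (Fin n)))‖ = 1 := by
      have : (EuclideanSpace.proj i : StrongDual ℝ (EuclideanSpace ℝ (Fin n))) =
        innerSL ℝ (EuclideanSpace.single i (1:ℝ)) := by
        ext x; simp [EuclideanSpace.inner_single_left]
      rw [this, innerSL_apply_norm]; simp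
    rw [h2] at h
    simpa using h
  simp [this]

theorem ssd_step_bound {n : ℕ} (F : EuclideanSpace ℝ (Fin n) → ℝ) (C : NNReal)
    (hF : LipschitzWith C F) (θ : ℝ) (x y : EuclideanSpace ℝ (Fin n)) :
    |F (Real.cos θ • x + Real.sin θ • y) - F x| ≤ |θ| * (C * (‖x‖ + ‖y‖)) := by
  have h1 := hF.dist_le_mul (Real.cos θ • x + Real.sin θ • y) x
  rw [Real.dist_eq, dist_eq_norm] at h1
  have h2 : ‖Real.cos θ • x + Real.sin θ • y - x‖ ≤ |θ| * (‖x‖ + ‖y‖) := by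
    have : Real.cos θ • x + Real.sin θ • y - x = (Real.cos θ - 1) • x + Real.sin θ • y := by
      rw [sub_smul, one_smul]; abel
    rw [this]
    refine (norm_add_le _ _).trans ?_
    rw [norm_smul, norm_smul, mul_add, Real.norm_eq_abs, Real.norm_eq_abs]
    have hc : |Real.cos θ - 1| ≤ |θ| := by
      have := Real.abs_cos_sub_cos_le θ 0
      simpa using this
    have hs : |Real.sin θ| ≤ |θ| := Real.abs_sin_le_abs
    gcongr
  calc _ ≤ _ := h1
    _ ≤ C * (|θ| * (‖x‖ + ‖y‖)) := by gcongr
    _ = _ := by ring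

theorem ssd_dom_integrable (n : ℕ) (C : NNReal) :
    Integrable (fun p : EuclideanSpace ℝ (Fin n) × EuclideanSpace ℝ (Fin n) =>
      ((C : ℝ) * (‖p.1‖ + ‖p.2‖)) ^ 2) ((stdGaussian (EuclideanSpace ℝ (Fin n))).prod
        (stdGaussian (EuclideanSpace ℝ (Fin n)))) := by
  have h : MemLp (fun x : EuclideanSpace ℝ (Fin n) => ‖x‖) 2
    (stdGaussian (EuclideanSpace ℝ (Fin n))) := IsGaussian.memLp_two_id.norm
  exact (((h.comp_fst _).add (h.comp_snd _)).const_mul (C : ℝ)).integrable_sq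

theorem ssd_deriv_tendsto {n : ℕ} (F : EuclideanSpace ℝ (Fin n) → ℝ)
    (x y : EuclideanSpace ℝ (Fin n)) (hd : DifferentiableAt ℝ F x) :
    Filter.Tendsto (fun N : ℕ => (((N : ℝ) + 1) *
      (F (Real.cos (Real.pi / 2 / (N + 1)) • x + Real.sin (Real.pi / 2 / (N + 1)) • y) - F x)) ^ 2)
      Filter.atTop (nhds ((Real.pi / 2 * fderiv ℝ F x y) ^ 2)) := by
  have h1 : HasDerivAt (fun θ : ℝ => Real.cos θ • x + Real.sin θ • y) y 0 := by
    have := ((Real.hasDerivAt_cos 0).smul_const x).add ((Real.hasDerivAt_sin 0).smul_const y)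
    simp only [Real.sin_zero, Real.cos_zero, neg_zero, zero_smul, one_smul, zero_add] at this
    exact this
  have h2 : HasDerivAt (fun θ : ℝ => F (Real.cos θ • x + Real.sin θ • y)) (fderiv ℝ F x y) 0 := by
    have hd' : HasFDerivAt F (fderiv ℝ F x) (Real.cos 0 • x + Real.sin 0 • y) := by
      simpa using hd.hasFDerivAt
    exact hd'.comp_hasDerivAt (0 : ℝ) h1
  have h3 := h2.tendsto_slope_zero
  have h4 : Filter.Tendsto (fun N : ℕ => Real.pi / 2 / ((N : ℝ) + 1)) Filter.atTop
      (nhdsWithin 0 {0}ᶜ) := by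
    rw [tendsto_nhdsWithin_iff]
    constructor
    · have := (tendsto_one_div_add_atTop_nhds_zero_nat (𝕜 := ℝ)).const_mul (Real.pi / 2)
      simpa [div_eq_mul_inv] using this
    · refine Filter.Eventually.of_forall fun N => ?_
      have : (0:ℝ) < Real.pi / 2 / ((N : ℝ) + 1) := by positivity
      exact this.ne'
  have h5 := ((h3.comp h4).const_mul (Real.pi / 2)).pow 2
  refine h5.congr fun N => ?_
  have hpi := Real.pi_ne_zero
  have hN : (N : ℝ) + 1 ≠ 0 := by positivity
  simp only [Function.comp, zero_add, Real.cos_zero, Real.sin_zero, one_smul, zero_smul, add_zero,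
    smul_eq_mul]
  congr 1
  field_simp

theorem ssd_chain {n : ℕ} (F : EuclideanSpace ℝ (Fin n) → ℝ) (C : NNReal)
    (hF : LipschitzWith C F) (N : ℕ) :
    ∫ p, (F p.2 - F p.1) ^ 2 ∂((stdGaussian (EuclideanSpace ℝ (Fin n))).prod
        (stdGaussian (EuclideanSpace ℝ (Fin n)))) ≤
    ∫ p, (((N : ℝ) + 1) * (F (Real.cos (Real.pi / 2 / (N + 1)) • p.1 +
      Real.sin (Real.pi / 2 / (N + 1)) • p.2) - F p.1)) ^ 2
      ∂((stdGaussian (EuclideanSpace ℝ (Fin n))).prod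
        (stdGaussian (EuclideanSpace ℝ (Fin n)))) := by
  set γ := stdGaussian (EuclideanSpace ℝ (Fin n)) with hγ
  set δ : ℝ := Real.pi / 2 / (N + 1) with hδ
  have hFc : Continuous F := hF.continuous
  set S : EuclideanSpace ℝ (Fin n) × EuclideanSpace ℝ (Fin n) → ℝ := fun p =>
    (F (Real.cos δ • p.1 + Real.sin δ • p.2) - F p.1) ^ 2 with hS
  have hSc : Continuous S := by fun_prop
  have hSi : Integrable S (γ.prod γ) := by
    refine ((ssd_dom_integrable n C).const_mul (|δ| ^ 2)).mono' hSc.aestronglyMeasurable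
      (ae_of_all _ fun p => ?_)
    rw [← mul_pow, Real.norm_eq_abs, abs_pow]
    exact pow_le_pow_left₀ (abs_nonneg _) (ssd_step_bound F C hF δ p.1 p.2) 2
  have hrot : ∀ θ : ℝ, MeasurePreserving
      (ContinuousLinearMap.rotation θ : EuclideanSpace ℝ (Fin n) × EuclideanSpace ℝ (Fin n) →L[ℝ]
        EuclideanSpace ℝ (Fin n) × EuclideanSpace ℝ (Fin n)) (γ.prod γ) (γ.prod γ) := fun θ =>
    ⟨by fun_prop, IsGaussian.map_rotation_eq_self_of_forall_strongDual_eq_zero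
      (fun L => integral_strongDual_stdGaussian L) θ⟩
  set R : ℕ → EuclideanSpace ℝ (Fin n) × EuclideanSpace ℝ (Fin n) → ℝ := fun k p =>
    S (ContinuousLinearMap.rotation (k * δ) p) with hR
  have hRi : ∀ k, Integrable (R k) (γ.prod γ) := fun k =>
    (hrot (k * δ)).integrable_comp_of_integrable hSi
  have hRint : ∀ k, ∫ p, R k p ∂(γ.prod γ) = ∫ p, S p ∂(γ.prod γ) := by
    intro k
    conv_rhs => rw [← (hrot (k * δ)).map_eq]
    rw [integral_map (by fun_prop) hSc.aestronglyMeasurable]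
  have hRval : ∀ k p, R k p = (F (Real.cos ((k + 1 : ℕ) * δ) • p.1 +
      Real.sin ((k + 1 : ℕ) * δ) • p.2) - F (Real.cos (k * δ) • p.1 + Real.sin (k * δ) • p.2)) ^ 2 := by
    intro k p
    simp only [hR, hS, ContinuousLinearMap.rotation_apply]
    congr 3
    push_cast
    rw [add_mul, one_mul, Real.cos_add, Real.sin_add]
    module
  have hend : ((N + 1 : ℕ) : ℝ) * δ = Real.pi / 2 := by
    rw [hδ]; push_cast; field_simp
  have hpt : ∀ p : EuclideanSpace ℝ (Fin n) × EuclideanSpace ℝ (Fin n),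
      (F p.2 - F p.1) ^ 2 ≤ ((N : ℝ) + 1) * ∑ k ∈ Finset.range (N + 1), R k p := by
    intro p
    have h := Finset.sum_range_sub (fun k : ℕ =>
      F (Real.cos (k * δ) • p.1 + Real.sin (k * δ) • p.2)) (N + 1)
    rw [hend] at h
    simp only [Nat.cast_zero, zero_mul, Real.cos_zero, Real.sin_zero, one_smul, zero_smul,
      add_zero, Real.cos_pi_div_two, Real.sin_pi_div_two, zero_add] at h
    rw [← h]
    refine sq_sum_le_card_mul_sum_sq.trans ?_
    simp only [Finset.card_range, hRval]
    push_cast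
    rfl
  calc ∫ p, (F p.2 - F p.1) ^ 2 ∂(γ.prod γ)
      ≤ ∫ p, ((N : ℝ) + 1) * ∑ k ∈ Finset.range (N + 1), R k p ∂(γ.prod γ) := by
        refine integral_mono_of_nonneg (ae_of_all _ fun p => sq_nonneg _) ?_ (ae_of_all _ hpt)
        exact (integrable_finsetSum _ fun k _ => hRi k).const_mul _
    _ = ((N : ℝ) + 1) ^ 2 * ∫ p, S p ∂(γ.prod γ) := by
        rw [integral_const_mul, integral_finsetSum _ fun k _ => hRi k]
        simp only [hRint]
        simp
        ring
    _ = _ := by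
        rw [← integral_const_mul]
        simp only [hS, mul_pow]

theorem ssd_poincare {n : ℕ} (F : EuclideanSpace ℝ (Fin n) → ℝ) (C : NNReal)
    (hF : LipschitzWith C F) :
    ∫ p, (F p.2 - F p.1) ^ 2 ∂((stdGaussian (EuclideanSpace ℝ (Fin n))).prod
        (stdGaussian (EuclideanSpace ℝ (Fin n)))) ≤ (Real.pi / 2) ^ 2 * (C : ℝ) ^ 2 := by
  set γ := stdGaussian (EuclideanSpace ℝ (Fin n)) with hγ
  have hFc : Continuous F := hF.continuous
  have hdiff : ∀ᵐ x ∂γ, DifferentiableAt ℝ F x :=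
    (ssd_gauss_ac n).ae_le hF.ae_differentiableAt
  have hdiff2 : ∀ᵐ p ∂(γ.prod γ), DifferentiableAt ℝ F p.1 :=
    Measure.quasiMeasurePreserving_fst.ae hdiff
  have hlim : ∀ᵐ p ∂(γ.prod γ), Filter.Tendsto (fun N : ℕ => (((N : ℝ) + 1) *
      (F (Real.cos (Real.pi / 2 / (N + 1)) • p.1 + Real.sin (Real.pi / 2 / (N + 1)) • p.2)
        - F p.1)) ^ 2)
      Filter.atTop (nhds ((Real.pi / 2 * fderiv ℝ F p.1 p.2) ^ 2)) := by
    filter_upwards [hdiff2] with p hp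
    exact ssd_deriv_tendsto F p.1 p.2 hp
  have hmeas : ∀ N : ℕ, AEStronglyMeasurable (fun p : EuclideanSpace ℝ (Fin n) ×
      EuclideanSpace ℝ (Fin n) => (((N : ℝ) + 1) *
      (F (Real.cos (Real.pi / 2 / (N + 1)) • p.1 + Real.sin (Real.pi / 2 / (N + 1)) • p.2)
        - F p.1)) ^ 2) (γ.prod γ) := fun N => Continuous.aestronglyMeasurable (by fun_prop)
  have hT := tendsto_integral_of_dominated_convergence
    (fun p => (Real.pi / 2) ^ 2 * ((C : ℝ) * (‖p.1‖ + ‖p.2‖)) ^ 2) hmeas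
    ((ssd_dom_integrable n C).const_mul _) (fun N => ae_of_all _ fun p => by
      rw [← mul_pow, Real.norm_eq_abs, abs_pow]
      refine pow_le_pow_left₀ (abs_nonneg _) ?_ 2
      rw [abs_mul]
      have hN : (0:ℝ) < (N : ℝ) + 1 := by positivity
      have h := ssd_step_bound F C hF (Real.pi / 2 / (N + 1)) p.1 p.2
      rw [abs_of_pos (by positivity : 0 < Real.pi / 2 / ((N:ℝ) + 1))] at h
      rw [abs_of_pos hN]
      calc _ ≤ ((N : ℝ) + 1) * (Real.pi / 2 / (N + 1) * (C * (‖p.1‖ + ‖p.2‖))) := by gcongr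
        _ = _ := by field_simp) hlim
  refine (ge_of_tendsto' hT fun N => ssd_chain F C hF N).trans ?_
  have hlm := aestronglyMeasurable_of_tendsto_ae Filter.atTop hmeas hlim
  have hfd : ∀ x, ‖fderiv ℝ F x‖ ≤ C := fun x => norm_fderiv_le_of_lipschitz ℝ hF
  have hli : Integrable (fun p : EuclideanSpace ℝ (Fin n) × EuclideanSpace ℝ (Fin n) =>
      (Real.pi / 2 * fderiv ℝ F p.1 p.2) ^ 2) (γ.prod γ) := by
    refine ((ssd_dom_integrable n C).const_mul ((Real.pi / 2) ^ 2)).mono' hlm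
      (ae_of_all _ fun p => ?_)
    rw [← mul_pow, Real.norm_eq_abs, abs_pow]
    refine pow_le_pow_left₀ (abs_nonneg _) ?_ 2
    rw [abs_mul, abs_of_pos (by positivity : 0 < Real.pi / 2)]
    have h1 := (fderiv ℝ F p.1).le_of_opNorm_le (hfd p.1) p.2
    rw [Real.norm_eq_abs] at h1
    have : (C : ℝ) * ‖p.2‖ ≤ C * (‖p.1‖ + ‖p.2‖) := by
      gcongr; linarith [norm_nonneg p.1]
    have := h1.trans this
    gcongr
  rw [integral_prod _ hli]
  have hin : ∀ x, ∫ y, (Real.pi / 2 * fderiv ℝ F x y) ^ 2 ∂γ = (Real.pi / 2) ^ 2 * ‖fderiv ℝ F x‖ ^ 2 := by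
    intro x
    have h := variance_dual_stdGaussian (fderiv ℝ F x)
    rw [variance_of_integral_eq_zero (by fun_prop) (integral_strongDual_stdGaussian _)] at h
    rw [← h, ← integral_const_mul]
    simp only [mul_pow]
    rfl
  calc _ ≤ ∫ x, (Real.pi / 2) ^ 2 * (C : ℝ) ^ 2 ∂γ := by
        refine integral_mono hli.integral_prod_left (integrable_const _) fun x => ?_
        simp only [hin]
        have := hfd x
        gcongr
    _ = _ := by simp

theorem ssd_odd_bound {n : ℕ} (F : EuclideanSpace ℝ (Fin n) → ℝ) (C : NNReal)
    (hF : LipschitzWith C F) (hodd : ∀ x, F (-x) = - F x) :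
    ∫ x, (F x) ^ 2 ∂(stdGaussian (EuclideanSpace ℝ (Fin n))) ≤
      Real.pi ^ 2 / 8 * (C : ℝ) ^ 2 := by
  have hp := ssd_poincare F C hF
  set γ := stdGaussian (EuclideanSpace ℝ (Fin n)) with hγ
  have hFc : Continuous F := hF.continuous
  have h0 : F 0 = 0 := by
    have := hodd 0
    rw [neg_zero] at this
    linarith
  have hm : MemLp F 2 γ := by
    refine ((IsGaussian.memLp_two_id (μ := γ)).norm.const_mul (C : ℝ)).mono'
      hFc.aestronglyMeasurable (ae_of_all _ fun x => ?_)
    have := hF.dist_le_mul x 0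
    simpa [h0] using this
  have hi : Integrable F γ := hm.integrable (by norm_num)
  have hz : ∫ x, F x ∂γ = 0 := by
    have h1 : γ.map (LinearIsometryEquiv.neg ℝ) = γ := stdGaussian_map _
    have h2 : ∫ x, F x ∂γ = ∫ x, F (-x) ∂γ := by
      conv_lhs => rw [← h1]
      rw [integral_map (by fun_prop) hFc.aestronglyMeasurable]
      rfl
    simp only [hodd, integral_neg] at h2
    linarith
  have hs := hm.integrable_sq
  have he : ∫ p, (F p.2 - F p.1) ^ 2 ∂(γ.prod γ) = 2 * ∫ x, (F x) ^ 2 ∂γ := by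
    have e1 : ∀ p : EuclideanSpace ℝ (Fin n) × EuclideanSpace ℝ (Fin n),
      (F p.2 - F p.1) ^ 2 = ((F p.1) ^ 2 + (F p.2) ^ 2) - 2 * (F p.1 * F p.2) := fun p => by ring
    simp_rw [e1]
    have hsum : Integrable (fun p : EuclideanSpace ℝ (Fin n) × EuclideanSpace ℝ (Fin n) =>
      (F p.1) ^ 2 + (F p.2) ^ 2) (γ.prod γ) := (hs.comp_fst _).add (hs.comp_snd _)
    rw [integral_sub hsum ((hi.mul_prod hi).const_mul 2),
      integral_add (hs.comp_fst _) (hs.comp_snd _), integral_const_mul, integral_prod_mul, hz,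
      integral_fun_fst (fun x => F x ^ 2), integral_fun_snd (fun x => F x ^ 2)]
    simp
    ring
  rw [he] at hp
  nlinarith

theorem ssd_homog_aux {n : ℕ} (h : EuclideanSpace ℝ (Fin n) → ℝ) (K : ℝ) (hK : 0 ≤ K)
    (hl : ∀ a b, |h a - h b| ≤ K * ‖a - b‖) (hb : ∀ a, |h a| ≤ K * ‖a‖)
    (u v : EuclideanSpace ℝ (Fin n)) (huv : ‖v‖ ≤ ‖u‖) :
    |‖u‖ * h (‖u‖⁻¹ • u) - ‖v‖ * h (‖v‖⁻¹ • v)| ≤ √2 * K * ‖u - v‖ := by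
  have hs2 : (1:ℝ) ≤ √2 := Real.one_le_sqrt.2 (by norm_num)
  rcases eq_or_ne u 0 with hu | hu
  · subst hu
    have : v = 0 := by simpa using huv
    subst this; simp
  have hr : 0 < ‖u‖ := norm_pos_iff.2 hu
  have ha : ‖‖u‖⁻¹ • u‖ = 1 := by rw [norm_smul, norm_inv, norm_norm]; field_simp
  have hha := hb (‖u‖⁻¹ • u)
  rw [ha, mul_one] at hha
  rcases eq_or_ne v 0 with hv | hv
  · subst hv
    simp only [norm_zero, zero_mul, sub_zero]
    rw [abs_mul, abs_norm]
    have : 1 * K * ‖u‖ ≤ √2 * K * ‖u‖ := by gcongr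
    nlinarith
  have hs : 0 < ‖v‖ := norm_pos_iff.2 hv
  have hbn : ‖‖v‖⁻¹ • v‖ = 1 := by rw [norm_smul, norm_inv, norm_norm]; field_simp
  set a := ‖u‖⁻¹ • u with hadef
  set b := ‖v‖⁻¹ • v with hbdef
  have hu' : u = ‖u‖ • a := by rw [hadef, smul_smul, mul_inv_cancel₀ hr.ne', one_smul]
  have hv' : v = ‖v‖ • b := by rw [hbdef, smul_smul, mul_inv_cancel₀ hs.ne', one_smul]
  have hd : ‖u - v‖ ^ 2 = (‖u‖ - ‖v‖) ^ 2 + ‖u‖ * ‖v‖ * ‖a - b‖ ^ 2 := by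
    have e1 : inner ℝ u v = ‖u‖ * ‖v‖ * inner ℝ a b := by
      conv_lhs => rw [hu', hv', real_inner_smul_left, real_inner_smul_right]
      ring
    rw [norm_sub_sq_real, norm_sub_sq_real, ha, hbn, e1]
    ring
  have h1 : |‖u‖ * h a - ‖v‖ * h b| ≤ K * ((‖u‖ - ‖v‖) + ‖v‖ * ‖a - b‖) := by
    have e : ‖u‖ * h a - ‖v‖ * h b = (‖u‖ - ‖v‖) * h a + ‖v‖ * (h a - h b) := by ring
    rw [e]
    refine (abs_add_le _ _).trans ?_
    rw [abs_mul, abs_mul, abs_norm, abs_of_nonneg (sub_nonneg.2 huv)]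
    have := hl a b
    have i1 : (‖u‖ - ‖v‖) * |h a| ≤ (‖u‖ - ‖v‖) * K :=
      mul_le_mul_of_nonneg_left hha (sub_nonneg.2 huv)
    have i2 : ‖v‖ * |h a - h b| ≤ ‖v‖ * (K * ‖a - b‖) := by gcongr
    linarith
  have h2 : (‖u‖ - ‖v‖) + ‖v‖ * ‖a - b‖ ≤ √2 * ‖u - v‖ := by
    refine le_of_sq_le_sq ?_ (by positivity)
    rw [mul_pow, Real.sq_sqrt (by norm_num), hd]
    have : ‖v‖ * ‖v‖ * ‖a - b‖ ^ 2 ≤ ‖u‖ * ‖v‖ * ‖a - b‖ ^ 2 := by gcongr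
    nlinarith [sq_nonneg ((‖u‖ - ‖v‖) - ‖v‖ * ‖a - b‖)]
  calc _ ≤ _ := h1
    _ ≤ K * (√2 * ‖u - v‖) := by gcongr
    _ = _ := by ring

theorem ssd_homog {n : ℕ} (h : EuclideanSpace ℝ (Fin n) → ℝ) (K : ℝ) (hK : 0 ≤ K)
    (hl : ∀ a b, |h a - h b| ≤ K * ‖a - b‖) (hb : ∀ a, |h a| ≤ K * ‖a‖) :
    LipschitzWith (Real.toNNReal (√2 * K)) (fun u => ‖u‖ * h (‖u‖⁻¹ • u)) := by
  refine LipschitzWith.of_dist_le_mul fun u v => ?_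
  rw [Real.coe_toNNReal _ (by positivity), Real.dist_eq, dist_eq_norm]
  rcases le_total ‖v‖ ‖u‖ with huv | huv
  · exact ssd_homog_aux h K hK hl hb u v huv
  · rw [abs_sub_comm, norm_sub_rev]
    exact ssd_homog_aux h K hK hl hb v u huv

/-- For `g : ℝ^n → ℝ` that is `M`-Lipschitz w.r.t. the Euclidean norm and `e`
uniform on the Euclidean unit sphere (modelled as a rotation-invariant probability
measure supported on the sphere), for any fixed `x`:
`E[(g(e + x) − g(−e + x))²] ≤ 12 M² / n`. -/
theorem sphere_symmetric_difference_bound (n : ℕ) (hn : 0 < n) (M : ℝ)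
    (g : EuclideanSpace ℝ (Fin n) → ℝ)
    (hM : ∀ u v, |g u - g v| ≤ M * ‖u - v‖)
    (P : Measure (EuclideanSpace ℝ (Fin n))) [IsProbabilityMeasure P]
    (hsphere : ∀ᵐ e ∂P, ‖e‖ = 1)
    (hinv : ∀ O : EuclideanSpace ℝ (Fin n) ≃ₗᵢ[ℝ] EuclideanSpace ℝ (Fin n),
      P.map O = P)
    (x : EuclideanSpace ℝ (Fin n)) :
    (∫ e, (g (e + x) - g (-e + x)) ^ 2 ∂P) ≤ 12 * M ^ 2 / n := by
  have hM0 : 0 ≤ M := by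
    have h := (abs_nonneg _).trans (hM (EuclideanSpace.single ⟨0, hn⟩ 1) 0)
    simpa using h
  set h : EuclideanSpace ℝ (Fin n) → ℝ := fun e => g (e + x) - g (-e + x) with hh
  have hl : ∀ a b, |h a - h b| ≤ 2 * M * ‖a - b‖ := by
    intro a b
    have e : h a - h b = (g (a + x) - g (b + x)) - (g (-a + x) - g (-b + x)) := by
      simp only [hh]; ring
    have h1 := hM (a + x) (b + x)
    have h2 := hM (-a + x) (-b + x)
    rw [add_sub_add_right_eq_sub] at h1 h2
    rw [show -a - -b = -(a - b) by abel, norm_neg] at h2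
    rw [e]
    exact (abs_sub _ _).trans (by linarith)
  have hb : ∀ a, |h a| ≤ 2 * M * ‖a‖ := by
    intro a
    have h1 := hM (a + x) (-a + x)
    rw [add_sub_add_right_eq_sub, sub_neg_eq_add, ← two_smul ℝ a, norm_smul] at h1
    simp only [Real.norm_ofNat] at h1
    simp only [hh]
    linarith
  have hoddh : ∀ a, h (-a) = - h a := by
    intro a; simp only [hh, neg_neg]; ring
  have hF := ssd_homog h (2 * M) (by positivity) hl hb
  set F : EuclideanSpace ℝ (Fin n) → ℝ := fun u => ‖u‖ * h (‖u‖⁻¹ • u) with hFdef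
  have hFc : Continuous F := hF.continuous
  have hkey := ssd_odd_bound F _ hF (fun u => by
    simp only [hFdef, norm_neg, smul_neg, hoddh]; ring)
  rw [Real.coe_toNNReal _ (by positivity)] at hkey
  rw [← ssd_gauss_polar P hsphere hinv, integral_map (by fun_prop)
    (by fun_prop : Continuous fun y => F y ^ 2).aestronglyMeasurable] at hkey
  have hae : ∀ᵐ p ∂((stdGaussian (EuclideanSpace ℝ (Fin n))).prod P),
      F (‖p.1‖ • p.2) ^ 2 = ‖p.1‖ ^ 2 * (h p.2) ^ 2 := by
    filter_upwards [Measure.quasiMeasurePreserving_snd.ae hsphere] with p hp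
    simp only [hFdef, norm_smul, norm_norm, hp, mul_one]
    rcases eq_or_ne ‖p.1‖ 0 with h0 | h0
    · simp [h0]
    · rw [smul_smul, inv_mul_cancel₀ h0, one_smul, mul_pow]
  rw [integral_congr_ae hae, integral_prod_mul (fun y => ‖y‖ ^ 2) (fun y => h y ^ 2),
    ssd_gauss_norm_sq] at hkey
  have hn' : (0:ℝ) < n := by exact_mod_cast hn
  rw [le_div_iff₀ hn', mul_comm]
  refine hkey.trans ?_
  rw [mul_pow, Real.sq_sqrt (by norm_num)]
  have hpi : Real.pi ^ 2 ≤ 12 := by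
    nlinarith [Real.pi_lt_d2, Real.pi_pos]
  nlinarith [mul_le_mul_of_nonneg_right hpi (sq_nonneg M)]
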